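/- Let 𝒢 be the graphical coordination game on the ring (cycle graph) with n ≥ 3 players and no risk-dominant strategy, i.e. δ₀ = δ₁ = δ > 0, and consider the logit dynamics with inverse noise β ≥ 0. Then the transition probability out of the all-ones profile 1 satisfies ∑_{y ≠ 1} P(1, y) = 1/(1 + e^{2δβ}), and for every ε ∈ (0,1/2), for every integer t < (1 − 2ε)·(1 + e^{2δβ})/2, there exists a starting profile x with ‖P^t(x,·) − π‖_TV > ε; in particular the mixing time satisfies t_mix(ε) ≥ (1 − 2ε)·(1 + e^{2δβ})/2 = Ω(1 + e^{2δβ}). -/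

import Mathlib

noncomputable section

open Finset

/-- Edge potential of the basic 2×2 coordination game:
`φ(0,0) = −δ₀`, `φ(1,1) = −δ₁`, `φ(0,1) = φ(1,0) = 0`. -/
def coordPhi (δ0 δ1 : ℝ) (a b : Bool) : ℝ :=
  if a = false ∧ b = false then -δ0 else if a = true ∧ b = true then -δ1 else 0

/-- Potential of the graphical coordination game on the (oriented) edge set `E`:
`Φ(x) = ∑_{(u,v) ∈ E} φ(x_u, x_v)`. -/
def graphPot {n : ℕ} (E : Finset (Fin n × Fin n)) (δ0 δ1 : ℝ) (x : Fin n → Bool) : ℝ :=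
  ∑ e ∈ E, coordPhi δ0 δ1 (x e.1) (x e.2)

/-- Gibbs measure `π(x) = exp(−β·Φ(x))/Z` on `{0,1}^n`. -/
def gibbsB {n : ℕ} (β : ℝ) (Φ : (Fin n → Bool) → ℝ) (x : Fin n → Bool) : ℝ :=
  Real.exp (-β * Φ x) / ∑ y : Fin n → Bool, Real.exp (-β * Φ y)

/-- Logit update probability expressed via the potential:
`σ_i(z ∣ x) = exp(−β·Φ(z,x_{−i})) / ∑_{w∈{0,1}} exp(−β·Φ(w,x_{−i}))`. -/
def sigmaB {n : ℕ} (β : ℝ) (Φ : (Fin n → Bool) → ℝ) (i : Fin n) (z : Bool)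
    (x : Fin n → Bool) : ℝ :=
  Real.exp (-β * Φ (Function.update x i z)) /
    ∑ w : Bool, Real.exp (-β * Φ (Function.update x i w))

/-- Transition matrix of the logit dynamics with inverse noise `β` on `{0,1}^n`. -/
def logitPB {n : ℕ} (β : ℝ) (Φ : (Fin n → Bool) → ℝ) :
    Matrix (Fin n → Bool) (Fin n → Bool) ℝ := fun x y =>
  (1 / (n : ℝ)) *
    ∑ i, if y = Function.update x i (y i) then sigmaB β Φ i (y i) x else 0

/-- Total variation distance `(1/2)·∑ z, |μ z − ν z|`. -/
def tvDist {α : Type*} [Fintype α] (μ ν : α → ℝ) : ℝ :=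
  (1 / 2) * ∑ z, |μ z - ν z|

/-- Potential of the graphical coordination game on the ring (cycle) with `n` players and
no risk-dominant strategy (`δ₀ = δ₁ = δ`): player `i` plays the basic game with players
`i−1` and `i+1` (mod `n`). -/
def ringPot (n : ℕ) [NeZero n] (δ : ℝ) (x : Fin n → Bool) : ℝ :=
  ∑ i : Fin n, coordPhi δ δ (x i) (x (i + 1))

lemma sum_ite_eq_update_eq_sum_bool {n : ℕ} (x : Fin n → Bool) (i : Fin n) (f : Bool → ℝ) :
    (∑ y : Fin n → Bool, if y = Function.update x i (y i) then f (y i) else 0) = ∑ w, f w := by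
  have key : ∀ y : Fin n → Bool, (if y = Function.update x i (y i) then f (y i) else 0) =
      ∑ w, if y = Function.update x i w then f w else 0 := by
    intro y
    rw [Finset.sum_eq_single (y i)]
    · intro w _ hw
      refine if_neg fun h => hw ?_
      rw [h, Function.update_self]
    · simp
  simp_rw [key]
  rw [Finset.sum_comm]
  simp

lemma sum_sigmaB {n : ℕ} (β : ℝ) (Φ : (Fin n → Bool) → ℝ) (i : Fin n) (x : Fin n → Bool) :
    ∑ w, sigmaB β Φ i w x = 1 := by
  unfold sigmaB
  rw [← Finset.sum_div]
  exact div_self (Finset.sum_pos (fun _ _ => Real.exp_pos _) Finset.univ_nonempty).ne'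

lemma sum_logitPB {n : ℕ} [NeZero n] (β : ℝ) (Φ : (Fin n → Bool) → ℝ) (x : Fin n → Bool) :
    ∑ y, logitPB β Φ x y = 1 := by
  unfold logitPB
  rw [← Finset.mul_sum, Finset.sum_comm]
  have key : ∀ i : Fin n, (∑ y : Fin n → Bool,
      if y = Function.update x i (y i) then sigmaB β Φ i (y i) x else 0) = 1 := fun i =>
    (sum_ite_eq_update_eq_sum_bool x i fun w => sigmaB β Φ i w x).trans (sum_sigmaB β Φ i x)
  have hn0 : (n : ℝ) ≠ 0 := NeZero.ne _
  simp [key, hn0]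

lemma logitPB_nonneg {n : ℕ} (β : ℝ) (Φ : (Fin n → Bool) → ℝ) (x y : Fin n → Bool) :
    0 ≤ logitPB β Φ x y := by
  unfold logitPB
  refine mul_nonneg (by positivity) (Finset.sum_nonneg fun i _ => ?_)
  split_ifs
  · exact div_nonneg (Real.exp_pos _).le (Finset.sum_nonneg fun _ _ => (Real.exp_pos _).le)
  · exact le_rfl

lemma Matrix.pow_apply_nonneg_of_nonneg {α : Type*} [Fintype α] [DecidableEq α]
    {P : Matrix α α ℝ} (hP : ∀ x y, 0 ≤ P x y) (t : ℕ) (x y : α) : 0 ≤ (P ^ t) x y := by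
  induction t generalizing y with
  | zero => rw [pow_zero, Matrix.one_apply]; split_ifs <;> norm_num
  | succ t ih =>
    rw [pow_succ, Matrix.mul_apply]
    exact Finset.sum_nonneg fun z _ => mul_nonneg (ih z) (hP z y)

lemma Matrix.sum_pow_apply_eq_one {α : Type*} [Fintype α] [DecidableEq α]
    {P : Matrix α α ℝ} (hP : ∀ x, ∑ y, P x y = 1) (t : ℕ) (x : α) : ∑ y, (P ^ t) x y = 1 := by
  induction t with
  | zero => simp [Matrix.one_apply]
  | succ t ih =>
    simp_rw [pow_succ, Matrix.mul_apply]
    rw [Finset.sum_comm]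
    simp_rw [← Finset.mul_sum, hP, mul_one, ih]

lemma Matrix.pow_diag_le_diag_pow {α : Type*} [Fintype α] [DecidableEq α]
    {P : Matrix α α ℝ} (hP : ∀ x y, 0 ≤ P x y) (t : ℕ) (x : α) : P x x ^ t ≤ (P ^ t) x x := by
  induction t with
  | zero => simp
  | succ t ih =>
    rw [pow_succ, pow_succ, Matrix.mul_apply]
    refine (mul_le_mul_of_nonneg_right ih (hP x x)).trans ?_
    exact Finset.single_le_sum (f := fun z => (P ^ t) x z * P z x)
      (fun z _ => mul_nonneg (Matrix.pow_apply_nonneg_of_nonneg hP t x z) (hP z x))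
      (Finset.mem_univ x)

lemma sub_le_tvDist {α : Type*} [Fintype α] [DecidableEq α] {μ ν : α → ℝ}
    (h : ∑ z, μ z = ∑ z, ν z) (x : α) : μ x - ν x ≤ tvDist μ ν := by
  unfold tvDist
  rw [← Finset.add_sum_erase _ _ (Finset.mem_univ x)] at h ⊢
  rw [← Finset.add_sum_erase _ _ (Finset.mem_univ x)] at h
  have h1 := Finset.abs_sum_le_sum_abs (fun z => μ z - ν z) (Finset.univ.erase x)
  rw [Finset.sum_sub_distrib] at h1
  have h2 := neg_abs_le (∑ z ∈ Finset.univ.erase x, μ z - ∑ z ∈ Finset.univ.erase x, ν z)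
  have h3 := le_abs_self (μ x - ν x)
  linarith

lemma sum_gibbsB {n : ℕ} (β : ℝ) (Φ : (Fin n → Bool) → ℝ) : ∑ x, gibbsB β Φ x = 1 := by
  unfold gibbsB
  rw [← Finset.sum_div]
  exact div_self (Finset.sum_pos (fun _ _ => Real.exp_pos _) Finset.univ_nonempty).ne'

lemma gibbsB_nonneg {n : ℕ} (β : ℝ) (Φ : (Fin n → Bool) → ℝ) (x : Fin n → Bool) :
    0 ≤ gibbsB β Φ x :=
  div_nonneg (Real.exp_pos _).le (Finset.sum_nonneg fun _ _ => (Real.exp_pos _).le)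

lemma ringPot_const (n : ℕ) [NeZero n] (δ : ℝ) (b : Bool) :
    ringPot n δ (fun _ => b) = -(n * δ) := by
  cases b <;> simp [ringPot, coordPhi]

lemma gibbsB_ringPot_true_le_half (n : ℕ) [NeZero n] (δ β : ℝ) :
    gibbsB β (ringPot n δ) (fun _ => true) ≤ 1 / 2 := by
  have hne : (fun _ : Fin n => true) ≠ fun _ => false := fun h => by
    simpa using congrFun h 0
  have heq : gibbsB β (ringPot n δ) (fun _ => false) = gibbsB β (ringPot n δ) (fun _ => true) := by
    simp only [gibbsB, ringPot_const]
  have h := Finset.sum_le_sum_of_subset_of_nonneg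
    (f := gibbsB β (ringPot n δ)) (Finset.subset_univ {(fun _ : Fin n => true), fun _ => false})
    (fun x _ _ => gibbsB_nonneg _ _ x)
  rw [sum_gibbsB, Finset.sum_pair hne, heq] at h
  linarith

lemma ringPot_update_true_false (n : ℕ) [NeZero n] (hn : 2 ≤ n) (δ : ℝ) (i : Fin n) :
    ringPot n δ (Function.update (fun _ => true) i false) = -(n * δ) + 2 * δ := by
  have hone : (1 : Fin n) ≠ 0 := by
    intro h
    have := congrArg Fin.val h
    rw [Fin.val_one', Nat.mod_eq_of_lt (by omega), Fin.val_zero] at this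
    omega
  have key : ∀ j : Fin n, coordPhi δ δ (Function.update (fun _ => true) i false j)
      (Function.update (fun _ => true) i false (j + 1)) =
      -δ + (if j = i then δ else 0) + (if j = i - 1 then δ else 0) := by
    intro j
    by_cases h1 : j = i
    · subst h1
      have h2 : j ≠ j - 1 := fun h => hone (sub_eq_self.mp h.symm)
      simp [h2, hone, coordPhi]
    · by_cases h2 : j = i - 1
      · subst h2
        simp [h1, coordPhi]
      · have h3 : j + 1 ≠ i := fun h => h2 (eq_sub_of_add_eq h)
        simp [h1, h2, h3, coordPhi]
  simp only [ringPot, key, Finset.sum_add_distrib, Finset.sum_ite_eq', Finset.mem_univ, if_true]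
  simp
  ring

lemma logitPB_ringPot_true_true (n : ℕ) [NeZero n] (hn : 2 ≤ n) (δ β : ℝ) :
    logitPB β (ringPot n δ) (fun _ => true) (fun _ => true) =
      1 - 1 / (1 + Real.exp (2 * δ * β)) := by
  have hup : ∀ i : Fin n, Function.update (fun _ : Fin n => true) i true = fun _ => true :=
    fun i => Function.update_eq_self i _
  have hσ : ∀ i : Fin n, sigmaB β (ringPot n δ) i true (fun _ => true) =
      1 - 1 / (1 + Real.exp (2 * δ * β)) := by
    intro i
    have hexp : Real.exp (-β * -(n * δ)) =
        Real.exp (-β * (-(n * δ) + 2 * δ)) * Real.exp (2 * δ * β) := by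
      rw [← Real.exp_add]; ring_nf
    have h1 := Real.exp_pos (-β * (-(n * δ) + 2 * δ))
    have h2 := Real.exp_pos (2 * δ * β)
    rw [sigmaB, Fintype.sum_bool, hup, ringPot_const, ringPot_update_true_false n hn, hexp]
    field_simp
    ring
  have hn0 : (n : ℝ) ≠ 0 := NeZero.ne _
  simp only [logitPB, hup, if_true, hσ, Finset.sum_const, Finset.card_univ, Fintype.card_fin,
    nsmul_eq_mul]
  field_simp

/-- For the graphical coordination game on the ring with `n ≥ 3`
players and no risk-dominant strategy (`δ₀ = δ₁ = δ > 0`): the total transition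
probability out of the all-ones profile is `1/(1 + e^{2δβ})`, and for every
`ε ∈ (0,1/2)` and every integer `t < (1 − 2ε)·(1 + e^{2δβ})/2` there is a starting
profile from which the chain at time `t` is more than `ε` away (in total variation)
from the Gibbs measure; in particular `t_mix(ε) ≥ (1 − 2ε)·(1 + e^{2δβ})/2`. -/
theorem ring_coordination_mixing_lower_bound
    (n : ℕ) [NeZero n] (hn : 3 ≤ n) (δ β : ℝ) (hδ : 0 < δ) (hβ : 0 ≤ β) :
    (∑ y ∈ Finset.univ.filter fun y : Fin n → Bool => y ≠ fun _ => true,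
        logitPB β (ringPot n δ) (fun _ => true) y) =
      1 / (1 + Real.exp (2 * δ * β)) ∧
    (∀ ε : ℝ, 0 < ε → ε < 1 / 2 → ∀ t : ℕ,
      (t : ℝ) < (1 - 2 * ε) * (1 + Real.exp (2 * δ * β)) / 2 →
      ∃ x : Fin n → Bool,
        tvDist ((logitPB β (ringPot n δ) ^ t) x) (gibbsB β (ringPot n δ)) > ε) := by
  have hP := logitPB_ringPot_true_true n (by omega : 2 ≤ n) δ β
  have hexp := Real.exp_pos (2 * δ * β)
  refine ⟨?_, fun ε _ _ t ht => ⟨fun _ => true, ?_⟩⟩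
  · have h := sum_logitPB β (ringPot n δ) (fun _ => true)
    rw [← Finset.add_sum_erase _ _ (Finset.mem_univ fun _ : Fin n => true), hP] at h
    rw [Finset.filter_ne']
    linarith
  · set p := 1 / (1 + Real.exp (2 * δ * β)) with hp
    have hp0 : 0 < p := by positivity
    have hp1 : p ≤ 1 := by
      rw [hp, div_le_one (by positivity)]
      linarith
    have htp : t * p < (1 - 2 * ε) / 2 := by
      rw [hp, mul_one_div, div_lt_iff₀ (by positivity)]
      linarith
    have hbern := one_add_mul_le_pow (by linarith : (-2 : ℝ) ≤ -p) t
    have hdiag := Matrix.pow_diag_le_diag_pow (logitPB_nonneg β (ringPot n δ)) t (fun _ => true)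
    rw [hP, sub_eq_add_neg] at hdiag
    have hgibbs := gibbsB_ringPot_true_le_half n δ β
    have htv := sub_le_tvDist
      ((Matrix.sum_pow_apply_eq_one (sum_logitPB β (ringPot n δ)) t (fun _ => true)).trans
        (sum_gibbsB β (ringPot n δ)).symm) (fun _ => true)
    linarith
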